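/- (Rounding lemma.) Let n be a positive integer and set Δ = (n+1)^{(n+1)/2}. Let 𝒳 ⊆ {0,1}^n be nonempty, let r = xcs(conv(𝒳)) be the semidefinite extension complexity of conv(𝒳), and let 0 < δ ≤ (16 r³ (n + r²))^{−1}. Then for every i ∈ {1,…,n+r²} there exist: an integer vector a_i ∈ ℤ^n with ‖a_i‖_∞ ≤ Δ; an integer b_i with |b_i| ≤ Δ; and an r×r PSD matrix U_i with ‖U_i‖ ≤ √(rΔ), whose entries are integer multiples of δ/Δ and have absolute value at most 8 r^{3/2} Δ, such that 𝒳 = {x ∈ {0,1}^n : ∃ Y ∈ S₊^r with ‖Y‖ ≤ √(rΔ) such that |b_i − a_iᵀx − Tr(Y U_i)| ≤ 1/(4(n+r²)) for all i ∈ {1,…,n+r²}}. -/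

import Mathlib

open Matrix

/-- Operator norm (ℓ² → ℓ²) of a square real matrix. -/
noncomputable def opNorm {r : ℕ} (M : Matrix (Fin r) (Fin r) ℝ) : ℝ :=
  ‖LinearMap.toContinuousLinearMap (Matrix.toEuclideanLin M)‖

/-- `K` has a semidefinite extended formulation of size `r`. -/
def HasSdpEF {n : ℕ} (K : Set (Fin n → ℝ)) (r : ℕ) : Prop :=
  ∃ (m : ℕ) (a : Fin m → (Fin n → ℝ)) (U : Fin m → Matrix (Fin r) (Fin r) ℝ) (b : Fin m → ℝ),
    (∀ i, (U i).PosSemidef) ∧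
    K = {x | ∃ Y : Matrix (Fin r) (Fin r) ℝ, Y.PosSemidef ∧
          ∀ i, a i ⬝ᵥ x + (U i * Y).trace = b i}

/-- Semidefinite extension complexity: the minimum size of a semidefinite EF. -/
noncomputable def xcs {n : ℕ} (K : Set (Fin n → ℝ)) : ℕ :=
  sInf {r | HasSdpEF K r}

open scoped MatrixOrder in
theorem Matrix.PosSemidef.exists_eq_transpose_mul_self {ι : Type*} [Fintype ι] [DecidableEq ι]
    {M : Matrix ι ι ℝ} (hM : M.PosSemidef) : ∃ B : Matrix ι ι ℝ, M = Bᵀ * B := by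
  obtain ⟨B, hB⟩ := CStarAlgebra.nonneg_iff_eq_star_mul_self.mp hM.nonneg
  exact ⟨B, by simpa [Matrix.star_eq_conjTranspose] using hB⟩

section PosSemidef

variable {r : ℕ}

theorem Matrix.PosSemidef.trace_mul_nonneg' {A B : Matrix (Fin r) (Fin r) ℝ} (hA : A.PosSemidef)
    (hB : B.PosSemidef) : 0 ≤ (A * B).trace := by
  obtain ⟨C, rfl⟩ := hB.exists_eq_transpose_mul_self
  have h := (hA.mul_mul_conjTranspose_same C).trace_nonneg
  rwa [Matrix.trace_mul_comm, conjTranspose_eq_transpose_of_trivial, ← Matrix.mul_assoc,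
    Matrix.trace_mul_comm] at h

theorem Matrix.PosSemidef.sq_apply_le {M : Matrix (Fin r) (Fin r) ℝ} (hM : M.PosSemidef)
    (k l : Fin r) : M k l ^ 2 ≤ M k k * M l l := by
  obtain ⟨B, rfl⟩ := hM.exists_eq_transpose_mul_self
  simp only [Matrix.mul_apply, Matrix.transpose_apply]
  simpa only [sq] using Finset.sum_mul_sq_le_sq_mul_sq Finset.univ (fun i => B i k) fun i => B i l

theorem Matrix.PosSemidef.abs_apply_le_trace {M : Matrix (Fin r) (Fin r) ℝ} (hM : M.PosSemidef)
    (k l : Fin r) : |M k l| ≤ M.trace := by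
  have hd : ∀ i, M i i ≤ M.trace := fun i =>
    Finset.single_le_sum (f := fun i => M i i) (fun _ _ => hM.diag_nonneg) (Finset.mem_univ i)
  refine abs_le_of_sq_le_sq ((hM.sq_apply_le k l).trans ?_) hM.trace_nonneg
  rw [sq]
  exact mul_le_mul (hd k) (hd l) hM.diag_nonneg hM.trace_nonneg

theorem abs_apply_le_opNorm (M : Matrix (Fin r) (Fin r) ℝ) (k l : Fin r) :
    |M k l| ≤ opNorm M := by
  have h := (LinearMap.toContinuousLinearMap (Matrix.toEuclideanLin M)).le_opNorm
    (EuclideanSpace.single l 1)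
  have h' := (PiLp.norm_apply_le (LinearMap.toContinuousLinearMap (Matrix.toEuclideanLin M)
    (EuclideanSpace.single l 1)) k).trans h
  simpa [opNorm, Matrix.toLpLin_apply] using h'

theorem Matrix.PosSemidef.opNorm_le_trace {M : Matrix (Fin r) (Fin r) ℝ} (hM : M.PosSemidef) :
    opNorm M ≤ M.trace := by
  refine ContinuousLinearMap.opNorm_le_bound _ hM.trace_nonneg fun x => ?_
  refine abs_le_of_sq_le_sq' ?_ (mul_nonneg hM.trace_nonneg (norm_nonneg _)) |>.2
  rw [mul_pow, EuclideanSpace.real_norm_sq_eq, EuclideanSpace.real_norm_sq_eq]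
  calc ∑ k, (M *ᵥ x) k ^ 2 ≤ ∑ k, (M k k * M.trace) * ∑ l, x l ^ 2 := by
        refine Finset.sum_le_sum fun k _ => ?_
        calc (M *ᵥ x) k ^ 2 ≤ (∑ l, M k l ^ 2) * ∑ l, x l ^ 2 :=
              Finset.sum_mul_sq_le_sq_mul_sq Finset.univ (M k) x
          _ ≤ _ := by
              refine mul_le_mul_of_nonneg_right ?_ (Finset.sum_nonneg fun _ _ => sq_nonneg _)
              rw [Matrix.trace, Finset.mul_sum]
              exact Finset.sum_le_sum fun l _ => hM.sq_apply_le k l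
    _ = _ := by rw [← Finset.sum_mul, ← Finset.sum_mul, sq]; rfl

theorem abs_trace_mul_le {Y E : Matrix (Fin r) (Fin r) ℝ} {c : ℝ} (hY : ∀ k l, |Y k l| ≤ c) :
    |(Y * E).trace| ≤ c * ∑ k, ∑ l, |E k l| := by
  simp only [Matrix.trace, Matrix.diag, Matrix.mul_apply]
  rw [Finset.sum_comm, Finset.mul_sum]
  refine (Finset.abs_sum_le_sum_abs _ _).trans (Finset.sum_le_sum fun k _ => ?_)
  rw [Finset.mul_sum]
  refine (Finset.abs_sum_le_sum_abs _ _).trans (Finset.sum_le_sum fun l _ => ?_)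
  rw [abs_mul]
  exact mul_le_mul_of_nonneg_right (hY _ _) (abs_nonneg _)

/-- Rounding a positive semidefinite matrix to the lattice `ε ℤ`, staying in the cone. -/
theorem Matrix.PosSemidef.exists_lattice_approx {U : Matrix (Fin r) (Fin r) ℝ} (hU : U.PosSemidef)
    {ε : ℝ} (hε : 0 < ε) :
    ∃ U' : Matrix (Fin r) (Fin r) ℝ, U'.PosSemidef ∧ (∀ k l, ∃ m : ℤ, U' k l = m * ε) ∧
      U'.trace ≤ U.trace + r ^ 2 * ε ∧ ∑ k, ∑ l, |(U' - U) k l| ≤ 2 * r ^ 2 * ε := by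
  let R : Matrix (Fin r) (Fin r) ℝ := .of fun k l => ⌊U k l / ε⌋ * ε
  have hR1 : ∀ k l, R k l ≤ U k l := fun k l => by
    simpa [R] using (le_div_iff₀ hε).mp (Int.floor_le (U k l / ε))
  have hR2 : ∀ k l, U k l - ε ≤ R k l := fun k l => by
    have := (div_lt_iff₀ hε).mp (Int.lt_floor_add_one (U k l / ε))
    simp only [R, Matrix.of_apply]
    linarith
  have hRU : ∀ k l, |(R - U) k l| ≤ ε := fun k l => by
    rw [Matrix.sub_apply, abs_le]
    constructor <;> linarith [hR1 k l, hR2 k l]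
  refine ⟨R + (r * ε) • 1, .of_dotProduct_mulVec_nonneg ?_ fun x => ?_, fun k l => ?_, ?_, ?_⟩
  · ext k l
    have : U l k = U k l := by simpa using hU.isHermitian.apply k l
    simp [R, this, Matrix.one_apply, eq_comm]
  · have h0 := hU.dotProduct_mulVec_nonneg x
    have h1 : |star x ⬝ᵥ ((R - U) *ᵥ x)| ≤ ε * (∑ k, |x k|) ^ 2 := by
      rw [sq, Finset.sum_mul_sum, Finset.mul_sum]
      refine (Finset.abs_sum_le_sum_abs _ _).trans (Finset.sum_le_sum fun k _ => ?_)
      rw [Matrix.mulVec, dotProduct, Finset.mul_sum, Finset.mul_sum]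
      refine (Finset.abs_sum_le_sum_abs _ _).trans (Finset.sum_le_sum fun l _ => ?_)
      rw [abs_mul, abs_mul, Pi.star_apply, star_trivial]
      have := mul_le_mul_of_nonneg_right (hRU k l)
        (mul_nonneg (abs_nonneg (x k)) (abs_nonneg (x l)))
      linarith
    have h2 : (∑ k, |x k|) ^ 2 ≤ r * ∑ k, x k ^ 2 := by
      simpa using sq_sum_le_card_mul_sum_sq (s := Finset.univ) (f := fun k => |x k|)
    have h3 : star x ⬝ᵥ x = ∑ k, x k ^ 2 := by simp [dotProduct, sq]
    have h4 : R + (r * ε) • 1 = U + (R - U) + (r * ε) • 1 := by abel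
    rw [h4, Matrix.add_mulVec, Matrix.add_mulVec, Matrix.smul_mulVec, Matrix.one_mulVec,
      dotProduct_add, dotProduct_add, dotProduct_smul, h3, smul_eq_mul]
    have := mul_le_mul_of_nonneg_left h2 hε.le
    linarith [(abs_le.mp h1).1]
  · refine ⟨⌊U k l / ε⌋ + if k = l then r else 0, ?_⟩
    by_cases h : k = l <;> simp [R, h, add_mul]
  · rw [Matrix.trace_add, Matrix.trace_smul, Matrix.trace_one, Fintype.card_fin, smul_eq_mul]
    have : R.trace ≤ U.trace := Finset.sum_le_sum fun k _ => hR1 k k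
    linarith
  · calc _ ≤ ∑ k : Fin r, ∑ l : Fin r, (ε + (r * ε) * (1 : Matrix (Fin r) (Fin r) ℝ) k l) := by
          refine Finset.sum_le_sum fun k _ => Finset.sum_le_sum fun l _ => ?_
          rw [add_sub_right_comm]
          refine (abs_add_le _ _).trans (add_le_add (hRU k l) ?_)
          rw [Matrix.smul_apply, smul_eq_mul, abs_of_nonneg]
          exact mul_nonneg (by positivity) (by rw [Matrix.one_apply]; positivity)
      _ = 2 * r ^ 2 * ε := by
          simp [Finset.sum_add_distrib, Matrix.one_apply]
          ring

end PosSemidef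

section Rescaling

variable {r : ℕ}

theorem trace_le_zero_of_det_one_add_smul_le {M : Matrix (Fin r) (Fin r) ℝ}
    (hM : ∀ t : ℝ, 0 < t → t ≤ 1 → (1 + t • M).det ≤ 1) : M.trace ≤ 0 := by
  set q := (1 + (Polynomial.X : Polynomial ℝ) • M.map Polynomial.C).det.divX.divX
  have hc : Continuous fun t : ℝ => M.trace + q.eval t * t := by fun_prop
  have ht : Filter.Tendsto (fun t : ℝ => M.trace + q.eval t * t) (nhdsWithin 0 (Set.Ioi 0))
      (nhds M.trace) := by
    simpa using (hc.tendsto 0).mono_left nhdsWithin_le_nhds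
  refine le_of_tendsto ht ?_
  filter_upwards [Ioc_mem_nhdsGT (zero_lt_one' ℝ)] with t ht
  have h := hM t ht.1 ht.2
  rw [Matrix.det_one_add_smul] at h
  have h' : t * (M.trace + q.eval t * t) ≤ 0 := by linarith
  exact nonpos_of_mul_nonpos_right h' ht.1

theorem isClosed_setOf_posSemidef : IsClosed {M : Matrix (Fin r) (Fin r) ℝ | M.PosSemidef} := by
  simp only [Matrix.posSemidef_iff_dotProduct_mulVec, Set.ofPred_and, Set.ofPred_forall]
  refine .inter (isClosed_eq (by fun_prop) continuous_id) (isClosed_iInter fun x => ?_)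
  exact isClosed_le continuous_const (by fun_prop)

/-- Any finite psd factorization can be rescaled so that the traces of the two families are
bounded by the size and by the largest entry, respectively. -/
theorem exists_rescaling {ι J : Type*} [Finite ι] [Finite J] {U : J → Matrix (Fin r) (Fin r) ℝ}
    {V : ι → Matrix (Fin r) (Fin r) ℝ} (hU : ∀ j, (U j).PosSemidef) (hV : ∀ y, (V y).PosSemidef)
    {c : ℝ} (hc : 0 < c) (hUV : ∀ j y, (U j * V y).trace ≤ c) :
    ∃ (U' : J → Matrix (Fin r) (Fin r) ℝ) (V' : ι → Matrix (Fin r) (Fin r) ℝ),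
      (∀ j, (U' j).PosSemidef) ∧ (∀ y, (V' y).PosSemidef) ∧
      (∀ j y, (U' j * V' y).trace = (U j * V y).trace) ∧
      (∀ j, (U' j).trace ≤ r) ∧ ∀ y, (V' y).trace ≤ c := by
  have := Fintype.ofFinite ι
  have := Fintype.ofFinite J
  set R : ℝ := 1 + ∑ j, (U j).trace
  have hR : ∀ j, (U j).trace ≤ R := fun j => by
    have := Finset.single_le_sum (f := fun j => (U j).trace) (fun j _ => (hU j).trace_nonneg)
      (Finset.mem_univ j)
    simp only [R]
    linarith
  have hR0 : 0 < R := add_pos_of_pos_of_nonneg one_pos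
    (Finset.sum_nonneg fun j _ => (hU j).trace_nonneg)
  let C : Set (Matrix (Fin r) (Fin r) ℝ) :=
    {M | M.PosSemidef ∧ M.trace ≤ R ∧ ∀ y, (M * V y).trace ≤ c}
  have hCconv : Convex ℝ C := by
    rintro A ⟨hA, hA1, hA2⟩ B ⟨hB, hB1, hB2⟩ s t hs ht hst
    refine ⟨(hA.smul hs).add (hB.smul ht), ?_, fun y => ?_⟩
    · rw [Matrix.trace_add, Matrix.trace_smul, Matrix.trace_smul]
      exact convex_Iic R hA1 hB1 hs ht hst
    · rw [Matrix.add_mul, Matrix.trace_add, Matrix.smul_mul, Matrix.smul_mul,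
        Matrix.trace_smul, Matrix.trace_smul]
      exact convex_Iic c (hA2 y) (hB2 y) hs ht hst
  have hCclosed : IsClosed C := by
    have hC : C = {M | M.PosSemidef} ∩ ({M | M.trace ≤ R} ∩ ⋂ y, {M | (M * V y).trace ≤ c}) := by
      ext M
      simp [C]
    rw [hC]
    exact isClosed_setOf_posSemidef.inter ((isClosed_le (by fun_prop) continuous_const).inter
      (isClosed_iInter fun y => isClosed_le (by fun_prop) continuous_const))
  have hCcompact : IsCompact C := by
    refine (isCompact_univ_pi fun _ : Fin r => isCompact_univ_pi fun _ : Fin r =>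
      isCompact_Icc (a := -R) (b := R)).of_isClosed_subset hCclosed ?_
    intro M hM k _ l _
    exact abs_le.mp ((hM.1.abs_apply_le_trace k l).trans hM.2.1)
  obtain ⟨t, ht0, ht⟩ : ∃ t : ℝ, 0 < t ∧ t • (1 : Matrix (Fin r) (Fin r) ℝ) ∈ C := by
    have hS : 0 ≤ ∑ y, (V y).trace := Finset.sum_nonneg fun y _ => (hV y).trace_nonneg
    refine ⟨min (R / (r + 1)) (c / (1 + ∑ y, (V y).trace)), lt_min (by positivity)
      (by positivity), Matrix.PosSemidef.one.smul (by positivity), ?_, fun y => ?_⟩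
    · rw [Matrix.trace_smul, Matrix.trace_one, Fintype.card_fin, smul_eq_mul]
      calc _ ≤ R / (r + 1) * (r + 1) := mul_le_mul (min_le_left _ _) (by linarith)
            (by positivity) (by positivity)
        _ = R := by field_simp
    · rw [Matrix.smul_mul, Matrix.one_mul, Matrix.trace_smul, smul_eq_mul]
      have h1 : (V y).trace ≤ ∑ y, (V y).trace :=
        Finset.single_le_sum (f := fun y => (V y).trace) (fun y _ => (hV y).trace_nonneg)
          (Finset.mem_univ y)
      calc _ ≤ c / (1 + ∑ y, (V y).trace) * (1 + ∑ y, (V y).trace) :=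
            mul_le_mul (min_le_right _ _) (by linarith) (hV y).trace_nonneg (by positivity)
        _ = c := by field_simp
  obtain ⟨M, hMC, hMmax⟩ := hCcompact.exists_isMaxOn ⟨_, ht⟩
    (f := Matrix.det) (by fun_prop)
  have hMdet : 0 < M.det := by
    refine lt_of_lt_of_le ?_ (hMmax ht)
    rw [Matrix.det_smul, Matrix.det_one]
    positivity
  obtain ⟨B, rfl⟩ := hMC.1.exists_eq_transpose_mul_self
  have hdetB : B.det ≠ 0 := fun h => by simp [h] at hMdet
  have hBunit : IsUnit B.det := hdetB.isUnit
  have hBi : B⁻¹ * B = 1 := Matrix.nonsing_inv_mul B hBunit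
  have hBt : Bᵀ * (B⁻¹)ᵀ = 1 := by rw [← Matrix.transpose_mul, hBi, Matrix.transpose_one]
  refine ⟨fun j => (B⁻¹)ᵀ * U j * B⁻¹, fun y => B * V y * Bᵀ, fun j => ?_, fun y => ?_,
    fun j y => ?_, fun j => ?_, fun y => ?_⟩
  · simpa using (hU j).conjTranspose_mul_mul_same B⁻¹
  · simpa using (hV y).mul_mul_conjTranspose_same B
  · calc _ = ((B⁻¹)ᵀ * (U j * (B⁻¹ * B) * V y * Bᵀ)).trace := by simp only [Matrix.mul_assoc]
      _ = (U j * V y * (Bᵀ * (B⁻¹)ᵀ)).trace := by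
        rw [hBi, Matrix.mul_one, Matrix.trace_mul_comm]
        simp only [Matrix.mul_assoc]
      _ = _ := by rw [hBt, Matrix.mul_one]
  · have hUC : U j ∈ C := ⟨hU j, hR j, hUV j⟩
    suffices ((B⁻¹)ᵀ * U j * B⁻¹ - 1).trace ≤ 0 by
      rwa [Matrix.trace_sub, Matrix.trace_one, Fintype.card_fin, sub_nonpos] at this
    refine trace_le_zero_of_det_one_add_smul_le fun s hs0 hs1 => ?_
    have h := hMmax (hCconv hMC hUC (sub_nonneg.mpr hs1) hs0.le (by ring))
    have he : (1 - s) • (Bᵀ * B) + s • U j =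
        Bᵀ * (1 + s • ((B⁻¹)ᵀ * U j * B⁻¹ - 1)) * B := by
      have : Bᵀ * ((B⁻¹)ᵀ * U j * B⁻¹) * B = U j := by
        calc _ = (Bᵀ * (B⁻¹)ᵀ) * U j * (B⁻¹ * B) := by simp only [Matrix.mul_assoc]
          _ = _ := by rw [hBt, hBi, Matrix.one_mul, Matrix.mul_one]
      rw [Matrix.mul_add, Matrix.add_mul, Matrix.mul_smul, Matrix.smul_mul, Matrix.mul_sub,
        Matrix.sub_mul, this, Matrix.mul_one, sub_smul, smul_sub, one_smul]
      abel
    simp only [Set.mem_ofPred_eq, he, Matrix.det_mul, Matrix.det_transpose] at h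
    rw [Matrix.det_mul, Matrix.det_transpose] at hMdet
    have h' : B.det * B.det * (1 + s • ((B⁻¹)ᵀ * U j * B⁻¹ - 1)).det ≤ B.det * B.det * 1 := by
      linarith
    exact le_of_mul_le_mul_left h' hMdet
  · have h := hMC.2.2 y
    rwa [Matrix.mul_assoc, Matrix.trace_mul_comm] at h

end Rescaling

section Spanner

open Module

/-- Barycentric spanner: every finite spanning family contains a basis with respect to which all
members of the family have coordinates in `[-1, 1]`. -/
theorem exists_barycentric_basis {E J : Type*} [AddCommGroup E] [Module ℝ E]
    [FiniteDimensional ℝ E] [Finite J] (w : J → E) (hw : Submodule.span ℝ (Set.range w) = ⊤) :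
    ∃ i : Fin (finrank ℝ E) → J, ∀ j, ∃ ν : Fin (finrank ℝ E) → ℝ,
      (∀ k, |ν k| ≤ 1) ∧ w j = ∑ k, ν k • w (i k) := by
  have key := Submodule.exists_fun_fin_finrank_span_eq ℝ (Set.range w)
  rw [hw, finrank_top] at key
  obtain ⟨f, hf, hfspan, hfli⟩ := key
  choose i₀ hi₀ using hf
  let e := Basis.mk hfli hfspan.ge
  obtain ⟨i, hi⟩ := @Finite.exists_max _ _ _ ⟨i₀⟩ _ fun i : Fin (finrank ℝ E) → J =>
    |e.det fun k => w (i k)|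
  have hdet : 0 < |e.det fun k => w (i k)| := by
    refine lt_of_lt_of_le ?_ (hi i₀)
    have : (fun k => w (i₀ k)) = e := by
      ext1 k
      simp [e, hi₀]
    simp [this, e.det_self]
  obtain ⟨hli, hsp⟩ := (Basis.is_basis_iff_det e).mpr (isUnit_iff_ne_zero.mpr (abs_pos.mp hdet))
  refine ⟨i, fun j => ⟨fun k => (Basis.mk hli hsp.ge).coord k (w j), fun k => ?_, ?_⟩⟩
  · have h := LinearMap.congr_fun (e.det_smul_mk_coord_eq_det_update hli hsp.ge k) (w j)
    have hu : Function.update (fun k => w (i k)) k (w j) =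
        fun l => w (Function.update i k j l) := by
      ext1 l
      by_cases hl : l = k
      · subst hl; simp
      · simp [hl]
    rw [LinearMap.smul_apply, MultilinearMap.toLinearMap_apply, hu, smul_eq_mul] at h
    have h' := hi (Function.update i k j)
    rw [AlternatingMap.coe_multilinearMap] at h
    rw [← h, abs_mul] at h'
    exact le_of_mul_le_mul_left (by simpa using h') hdet
  · simpa using ((Basis.mk hli hsp.ge).sum_repr (w j)).symm

theorem exists_barycentric_spanner {E J : Type*} [AddCommGroup E] [Module ℝ E]
    [FiniteDimensional ℝ E] [Finite J] [Nonempty J] (w : J → E) {N : ℕ} (hN : finrank ℝ E ≤ N) :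
    ∃ i : Fin N → J, ∀ j, ∃ ν : Fin N → ℝ, (∀ k, |ν k| ≤ 1) ∧ w j = ∑ k, ν k • w (i k) := by
  set S := Submodule.span ℝ (Set.range w)
  let w' : J → S := fun j => ⟨w j, Submodule.subset_span ⟨j, rfl⟩⟩
  have hw' : Submodule.span ℝ (Set.range w') = ⊤ := by
    apply Submodule.map_injective_of_injective S.injective_subtype
    rw [Submodule.map_span, ← Set.range_comp, Submodule.map_top, Submodule.range_subtype]
    rfl
  obtain ⟨i, hi⟩ := exists_barycentric_basis w' hw'
  obtain ⟨q, rfl⟩ := Nat.exists_eq_add_of_le ((Submodule.finrank_le S).trans hN)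
  refine ⟨Fin.append i fun _ => Classical.arbitrary J, fun j => ?_⟩
  obtain ⟨ν, hν, hj⟩ := hi j
  refine ⟨Fin.append ν 0, fun k => ?_, ?_⟩
  · refine Fin.addCases (fun k => ?_) (fun k => ?_) k
    · simpa using hν k
    · simp
  · have := congrArg (Subtype.val : S → E) hj
    simpa [Fin.sum_univ_add, w'] using this

end Spanner

section Factorization

variable {r : ℕ}

/-- Approximate psd factorization of a nonnegative vector, by conic duality: `s` is the vector of
values of a valid inequality, tight at `y₀`, at the points whose lifts are `V y`. -/
theorem exists_approx_factor {ι : Type*} [Fintype ι] {V : ι → Matrix (Fin r) (Fin r) ℝ}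
    (hV : ∀ y, (V y).PosSemidef) {s : ι → ℝ} {y₀ : ι} (hy₀ : s y₀ = 0)
    (hs : ∀ μ : ι → ℝ, ∑ y, μ y = 1 → (∑ y, μ y • V y).PosSemidef → 0 ≤ ∑ y, μ y * s y)
    {ε : ℝ} (hε : 0 < ε) :
    ∃ U : Matrix (Fin r) (Fin r) ℝ, U.PosSemidef ∧ ∀ y, |s y - (U * V y).trace| ≤ ε := by
  classical
  let D : Set (ι → ℝ) := {d | ∃ (U : Matrix (Fin r) (Fin r) ℝ) (κ : ℝ), U.PosSemidef ∧ 0 ≤ κ ∧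
    ∀ y, d y = (U * V y).trace + κ}
  have hDconv : Convex ℝ D := by
    rintro d ⟨U, κ, hU, hκ, hd⟩ d' ⟨U', κ', hU', hκ', hd'⟩ a b ha hb -
    refine ⟨a • U + b • U', a * κ + b * κ', (hU.smul ha).add (hU'.smul hb), by positivity,
      fun y => ?_⟩
    simp [hd, hd', Matrix.add_mul, Matrix.trace_add]
    ring
  have hsD : s ∈ closure D := by
    by_contra hsD
    obtain ⟨f, u, hfD, hfs⟩ := geometric_hahn_banach_closed_point hDconv.closure isClosed_closure hsD
    have hf : ∀ d, f d = ∑ y, d y * f (Pi.single y 1) := fun d => by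
      conv_lhs => rw [← Finset.univ_sum_single d, map_sum]
      refine Finset.sum_congr rfl fun y _ => ?_
      rw [← smul_eq_mul, ← map_smul, ← Pi.single_smul, smul_eq_mul, mul_one]
    have hu : 0 < u := by
      have := hfD 0 (subset_closure ⟨0, 0, .zero, le_rfl, by simp⟩)
      simpa using this
    have hfD' : ∀ d ∈ D, f d ≤ 0 := by
      rintro d ⟨U, κ, hU, hκ, hd⟩
      by_contra! h
      have := hfD ((u / f d) • d) (subset_closure ⟨(u / f d) • U, u / f d * κ,
        hU.smul (by positivity), by positivity, fun y => by simp [hd, mul_add]⟩)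
      rw [map_smul, smul_eq_mul, div_mul_cancel₀ _ h.ne'] at this
      exact this.false
    set μ : ι → ℝ := fun y => -f (Pi.single y 1) with hμ
    have hμf : ∀ d, f d = -∑ y, μ y * d y := fun d => by
      rw [hf]
      simp [hμ, mul_comm]
    have hμ1 : 0 ≤ ∑ y, μ y := by
      have := hfD' (fun _ => 1) ⟨0, 1, .zero, zero_le_one, by simp⟩
      rw [hμf] at this
      simpa using this
    have hμV : (∑ y, μ y • V y).PosSemidef := by
      refine .of_dotProduct_mulVec_nonneg ?_ fun x => ?_
      · refine isSelfAdjoint_sum _ fun y _ => ?_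
        exact IsSelfAdjoint.smul (IsSelfAdjoint.all (μ y)) (hV y).isHermitian
      · have := hfD' (fun y => star x ⬝ᵥ (V y *ᵥ x)) ⟨Matrix.vecMulVec x (star x), 0,
          Matrix.posSemidef_vecMulVec_self_star x, le_rfl, fun y => by
            rw [add_zero, Matrix.vecMulVec_mul, Matrix.trace_vecMulVec, dotProduct_comm,
              ← Matrix.dotProduct_mulVec]⟩
        rw [hμf, neg_nonpos] at this
        simpa [Matrix.sum_mulVec, Matrix.smul_mulVec, dotProduct_sum] using this
    have hμs : ∑ y, μ y * s y < 0 := by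
      have := hμf s
      linarith
    set t := 1 + ∑ y, μ y with ht
    have ht0 : 0 < t := by positivity
    let μ' : ι → ℝ := fun y => t⁻¹ * (μ y + (Pi.single y₀ 1 : ι → ℝ) y)
    have hμ's : ∑ y, μ' y * s y = t⁻¹ * ∑ y, μ y * s y := by
      simp only [μ', mul_assoc, ← Finset.mul_sum, add_mul, Finset.sum_add_distrib]
      simp [Pi.single_apply, hy₀]
    have h := hs μ' (by
      simp only [μ', ← Finset.mul_sum, Finset.sum_add_distrib]
      rw [Finset.sum_pi_single' y₀ (1 : ℝ)]
      simp only [Finset.mem_univ, if_true]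
      rw [add_comm, ← ht, inv_mul_cancel₀ ht0.ne']) (by
      have : ∑ y, μ' y • V y = t⁻¹ • (∑ y, μ y • V y + V y₀) := by
        simp [μ', mul_smul, add_smul, ← Finset.smul_sum, Finset.sum_add_distrib, Pi.single_apply]
      rw [this]
      exact (hμV.add (hV y₀)).smul (by positivity))
    rw [hμ's] at h
    have := mul_neg_of_pos_of_neg (inv_pos.mpr ht0) hμs
    linarith
  obtain ⟨d, ⟨U, κ, hU, hκ, hd⟩, hsd⟩ := Metric.mem_closure_iff.mp hsD (ε / 2) (half_pos hε)
  have hdy : ∀ y, |s y - d y| < ε / 2 := fun y =>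
    (Real.dist_eq _ _ ▸ dist_le_pi_dist s d y).trans_lt hsd
  refine ⟨U, hU, fun y => ?_⟩
  have h0 := abs_lt.mp (hdy y₀)
  have h1 := abs_lt.mp (hdy y)
  have h2 := hU.trace_mul_nonneg' (hV y₀)
  rw [hd, hy₀] at h0
  rw [hd] at h1
  rw [abs_le]
  constructor <;> linarith

end Factorization

section Cuts

variable {n : ℕ}

/-- The tight translate of the no-good cut excluding the 0/1 point `x`. -/
theorem exists_integer_cut {𝒳 : Set (Fin n → ℝ)} (hfin : 𝒳.Finite) (hne : 𝒳.Nonempty)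
    (h01 : ∀ y ∈ 𝒳, ∀ k, y k = 0 ∨ y k = 1) {x : Fin n → ℝ} (hx : ∀ k, x k = 0 ∨ x k = 1)
    (hx𝒳 : x ∉ 𝒳) :
    ∃ (a : Fin n → ℤ) (b : ℤ), (∀ k, |(a k : ℝ)| ≤ 1) ∧ |(b : ℝ)| ≤ n ∧
      (∀ y ∈ 𝒳, 0 ≤ (b : ℝ) - (fun k => (a k : ℝ)) ⬝ᵥ y ∧
        (b : ℝ) - (fun k => (a k : ℝ)) ⬝ᵥ y ≤ n - 1) ∧
      (∃ y ∈ 𝒳, (b : ℝ) - (fun k => (a k : ℝ)) ⬝ᵥ y = 0) ∧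
      (b : ℝ) - (fun k => (a k : ℝ)) ⬝ᵥ x ≤ -1 := by
  classical
  let h : (Fin n → ℝ) → ℕ := fun y => Finset.card {k | y k ≠ x k}
  obtain ⟨y₀, hy₀, hmin⟩ := Set.exists_min_image 𝒳 h hfin hne
  have hpos : ∀ y ∈ 𝒳, 1 ≤ h y := fun y hy => by
    rw [Nat.one_le_iff_ne_zero, Finset.card_ne_zero]
    obtain ⟨k, hk⟩ := Function.ne_iff.mp (ne_of_mem_of_not_mem hy hx𝒳)
    exact ⟨k, by simpa using hk⟩
  have hle : ∀ y, h y ≤ n := fun y => by simpa using Finset.card_le_univ {k | y k ≠ x k}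
  let a : Fin n → ℤ := fun k => if x k = 1 then 1 else -1
  let c : ℕ := Finset.card {k | x k = 1}
  have hc : c ≤ n := by simpa using Finset.card_le_univ {k | x k = 1}
  have hslack : ∀ y, (∀ k, y k = 0 ∨ y k = 1) → (c : ℝ) - (fun k => (a k : ℝ)) ⬝ᵥ y = h y := by
    intro y hy
    simp only [c, h, a, Finset.card_filter, dotProduct, Nat.cast_sum]
    rw [← Finset.sum_sub_distrib]
    refine Finset.sum_congr rfl fun k _ => ?_
    rcases hx k with hxk | hxk <;> rcases hy k with hyk | hyk <;> simp [hxk, hyk]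
  have hxx : h x = 0 := by simp [h]
  refine ⟨a, c - h y₀, fun k => ?_, ?_, fun y hy => ?_, ⟨y₀, hy₀, ?_⟩, ?_⟩
  · by_cases hk : x k = 1 <;> simp [a, hk]
  · have h1 : (c : ℝ) ≤ n := mod_cast hc
    have h2 : (h y₀ : ℝ) ≤ n := mod_cast hle y₀
    rw [abs_le]
    push_cast
    constructor <;> linarith [Nat.cast_nonneg (α := ℝ) c, Nat.cast_nonneg (α := ℝ) (h y₀)]
  · have h1 : (h y₀ : ℝ) ≤ h y := mod_cast hmin y hy
    have h2 : (h y : ℝ) ≤ n := mod_cast hle y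
    have h3 : (1 : ℝ) ≤ h y₀ := mod_cast hpos y₀ hy₀
    have h4 := hslack y (h01 y hy)
    push_cast
    constructor <;> linarith
  · have h4 := hslack y₀ (h01 y₀ hy₀)
    push_cast
    linarith
  · have h3 : (1 : ℝ) ≤ h y₀ := mod_cast hpos y₀ hy₀
    have h4 := hslack x hx
    rw [hxx] at h4
    push_cast at h4 ⊢
    linarith

end Cuts

/-- Lemma 4.1 (Rounding lemma): with `Δ = (n+1)^{(n+1)/2}`, `𝒳 ⊆ {0,1}ⁿ`
nonempty, `r = xcs(conv 𝒳)` and `0 < δ ≤ (16r³(n+r²))⁻¹`, there exist integer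
vectors `a_i` and integers `b_i` bounded by `Δ`, and PSD matrices `U_i` of
operator norm at most `√(rΔ)` whose entries are integer multiples of `δ/Δ` of
absolute value at most `8r^{3/2}Δ`, such that `𝒳` is exactly the set of 0/1
points admitting `Y ∈ S₊^r`, `‖Y‖ ≤ √(rΔ)`, with
`|b_i − a_iᵀx − Tr(Y U_i)| ≤ 1/(4(n+r²))` for all `i`. -/
theorem rounding_lemma {n : ℕ} (hn : 0 < n)
    (Δ : ℝ) (hΔ : Δ = ((n : ℝ) + 1) ^ (((n : ℝ) + 1) / 2))
    (𝒳 : Set (Fin n → ℝ)) (h𝒳ne : 𝒳.Nonempty)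
    (h𝒳01 : ∀ x ∈ 𝒳, ∀ k, x k = 0 ∨ x k = 1)
    (r : ℕ) (hr : r = xcs (convexHull ℝ 𝒳))
    (δ : ℝ) (hδ0 : 0 < δ) (hδ : δ ≤ (16 * (r : ℝ) ^ 3 * ((n : ℝ) + (r : ℝ) ^ 2))⁻¹) :
    ∃ (a : Fin (n + r ^ 2) → (Fin n → ℤ)) (b : Fin (n + r ^ 2) → ℤ)
      (U : Fin (n + r ^ 2) → Matrix (Fin r) (Fin r) ℝ),
      (∀ i k, (|a i k| : ℝ) ≤ Δ) ∧
      (∀ i, (|b i| : ℝ) ≤ Δ) ∧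
      (∀ i, (U i).PosSemidef) ∧
      (∀ i, opNorm (U i) ≤ Real.sqrt (r * Δ)) ∧
      (∀ i k l, ∃ m : ℤ, U i k l = (m : ℝ) * (δ / Δ)) ∧
      (∀ i k l, |U i k l| ≤ 8 * (r : ℝ) ^ ((3 : ℝ) / 2) * Δ) ∧
      𝒳 = {x | (∀ k, x k = 0 ∨ x k = 1) ∧
            ∃ Y : Matrix (Fin r) (Fin r) ℝ, Y.PosSemidef ∧ opNorm Y ≤ Real.sqrt (r * Δ) ∧
              ∀ i, |(b i : ℝ) - (fun k => (a i k : ℝ)) ⬝ᵥ x - (Y * U i).trace| ≤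
                1 / (4 * ((n : ℝ) + (r : ℝ) ^ 2))} := by
  classical
  have hr0 : r ≠ 0 := by
    rintro rfl
    simp at hδ
    linarith
  have hEF : HasSdpEF (convexHull ℝ 𝒳) r := by
    rw [hr]
    exact Nat.sInf_mem (Nat.nonempty_of_pos_sInf (Nat.pos_of_ne_zero (hr ▸ hr0)))
  have hr1 : (1 : ℝ) ≤ r := mod_cast Nat.one_le_iff_ne_zero.mpr hr0
  have hn1 : (1 : ℝ) ≤ n := mod_cast hn
  have hΔn : (n : ℝ) + 1 ≤ Δ := by
    rw [hΔ]
    exact Real.self_le_rpow_of_one_le (by linarith) (by linarith)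
  have hΔ0 : 0 < Δ := by linarith
  set N : ℝ := (n : ℝ) + (r : ℝ) ^ 2 with hN
  have hN1 : 1 ≤ N := by nlinarith
  set η : ℝ := 1 / (8 * N) with hη
  have hη0 : 0 < η := by positivity
  have hηN : N * η = 1 / 8 := by
    rw [hη]
    field_simp
  have hη1 : η ≤ 1 := by nlinarith
  have hη2 : 1 / (4 * N) = 2 * η := by
    rw [hη]
    field_simp
    norm_num
  set P : ℝ := Real.sqrt (r * Δ) with hP
  have hP0 : 0 < P := Real.sqrt_pos.mpr (by positivity)
  have hPsq : P * P = r * Δ := Real.mul_self_sqrt (by positivity)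
  have hPle : P ≤ r * Δ := Real.sqrt_le_self_iff.mpr (Or.inr (by nlinarith))
  have hrδ : 2 * r ^ 3 * δ ≤ η := by
    have h := mul_le_mul_of_nonneg_left hδ (show 0 ≤ 2 * (r : ℝ) ^ 3 by positivity)
    refine h.trans_eq ?_
    rw [hη]
    field_simp
    norm_num
  have hfin : 𝒳.Finite := by
    refine (Set.Finite.pi fun _ : Fin n => Set.toFinite {(0 : ℝ), 1}).subset fun x hx k _ => ?_
    exact h𝒳01 x hx k
  -- the points to be cut off, together with an extra index for the trivial cut
  let S : Set (Fin n → ℝ) := {x | (∀ k, x k = 0 ∨ x k = 1) ∧ x ∉ 𝒳}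
  have : Finite S := by
    refine ((Set.Finite.pi fun _ : Fin n => Set.toFinite {(0 : ℝ), 1}).subset
      fun x hx k _ => ?_).to_subtype
    exact hx.1 k
  have : Fintype 𝒳 := hfin.fintype
  have hcut : ∀ j : Option S, ∃ (a : Fin n → ℤ) (b : ℤ), (∀ k, |(a k : ℝ)| ≤ 1) ∧
      |(b : ℝ)| ≤ n ∧ (∀ y ∈ 𝒳, 0 ≤ (b : ℝ) - (fun k => (a k : ℝ)) ⬝ᵥ y ∧
        (b : ℝ) - (fun k => (a k : ℝ)) ⬝ᵥ y ≤ n - 1) ∧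
      (∃ y ∈ 𝒳, (b : ℝ) - (fun k => (a k : ℝ)) ⬝ᵥ y = 0) ∧
      ∀ x ∈ j, (b : ℝ) - (fun k => (a k : ℝ)) ⬝ᵥ x ≤ -1 := by
    rintro (_ | x)
    · obtain ⟨y, hy⟩ := h𝒳ne
      have h0 : ∀ y : Fin n → ℝ, (fun _ => (0 : ℝ)) ⬝ᵥ y = 0 := zero_dotProduct
      refine ⟨0, 0, ?_, ?_, ?_, ⟨y, hy, ?_⟩, ?_⟩ <;> simp [h0, hn1]
    · simpa using exists_integer_cut hfin h𝒳ne h𝒳01 x.2.1 x.2.2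
  choose a b ha hb hslack htight hsep using hcut
  obtain ⟨m, α, W, β, -, hK⟩ := hEF
  have hlift : ∀ y : 𝒳, ∃ Y : Matrix (Fin r) (Fin r) ℝ, Y.PosSemidef ∧
      ∀ i, α i ⬝ᵥ (y : Fin n → ℝ) + (W i * Y).trace = β i := fun y => by
    have : (y : Fin n → ℝ) ∈ convexHull ℝ 𝒳 := subset_convexHull ℝ 𝒳 y.2
    rwa [hK] at this
  choose V hV hVlift using hlift
  have hvalid : ∀ j, ∀ x ∈ convexHull ℝ 𝒳, 0 ≤ (b j : ℝ) - (fun k => (a j k : ℝ)) ⬝ᵥ x := by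
    intro j x hx
    have hconv : Convex ℝ {x : Fin n → ℝ | (fun k => (a j k : ℝ)) ⬝ᵥ x ≤ b j} :=
      convex_halfSpace_le ⟨dotProduct_add _, fun c x => dotProduct_smul c _ x⟩ _
    exact sub_nonneg.mpr (convexHull_min (fun y hy => sub_nonneg.mp (hslack j y hy).1) hconv hx)
  have hfactor : ∀ j, ∃ U : Matrix (Fin r) (Fin r) ℝ, U.PosSemidef ∧ ∀ y : 𝒳,
      |((b j : ℝ) - (fun k => (a j k : ℝ)) ⬝ᵥ (y : Fin n → ℝ)) - (U * V y).trace| ≤ η := by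
    intro j
    obtain ⟨y₀, hy₀, hy₀'⟩ := htight j
    refine exists_approx_factor hV (y₀ := ⟨y₀, hy₀⟩)
      (s := fun y : 𝒳 => (b j : ℝ) - (fun k => (a j k : ℝ)) ⬝ᵥ (y : Fin n → ℝ)) hy₀'
      (fun μ hμ hμV => ?_) hη0
    have hmem : ∑ y : 𝒳, μ y • (y : Fin n → ℝ) ∈ convexHull ℝ 𝒳 := by
      rw [hK]
      refine ⟨_, hμV, fun i => ?_⟩
      calc _ = ∑ y, μ y * (α i ⬝ᵥ (y : Fin n → ℝ) + (W i * V y).trace) := by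
            simp [dotProduct_sum, Matrix.mul_sum, Matrix.trace_sum, mul_add,
              Finset.sum_add_distrib]
        _ = β i := by simp [hVlift, ← Finset.sum_mul, hμ]
    have h := hvalid j _ hmem
    simpa [dotProduct_sum, mul_sub, Finset.sum_sub_distrib, ← Finset.sum_mul, hμ] using h
  choose U₀ hU₀ hU₀V using hfactor
  obtain ⟨U₁, V₁, hU₁, hV₁, hUV₁, hU₁tr, hV₁tr⟩ := exists_rescaling hU₀ hV
    (c := n) (by linarith) fun j y => by
      have h1 := (abs_le.mp (hU₀V j y)).1
      have h2 := (hslack j y y.2).2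
      linarith
  -- balance the two families
  let U₂ := fun j => (n / P) • U₁ j
  let V₂ := fun y => (P / n) • V₁ y
  have hU₂ : ∀ j, (U₂ j).PosSemidef := fun j => (hU₁ j).smul (by positivity)
  have hV₂ : ∀ y, (V₂ y).PosSemidef := fun y => (hV₁ y).smul (by positivity)
  have hUV₂ : ∀ (j) (y : 𝒳), |((b j : ℝ) - (fun k => (a j k : ℝ)) ⬝ᵥ (y : Fin n → ℝ)) -
      (V₂ y * U₂ j).trace| ≤ η := fun j y => by
    have : (V₂ y * U₂ j).trace = (U₀ j * V y).trace := by
      rw [← hUV₁, Matrix.trace_mul_comm]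
      simp only [U₂, V₂, Matrix.smul_mul, Matrix.mul_smul, smul_smul, Matrix.trace_smul]
      rw [show P / n * (n / P) = 1 by field_simp, one_smul]
    rw [this]
    exact hU₀V j y
  have hV₂P : ∀ y, opNorm (V₂ y) ≤ P := fun y => by
    refine (hV₂ y).opNorm_le_trace.trans ?_
    rw [Matrix.trace_smul, smul_eq_mul]
    calc P / n * (V₁ y).trace ≤ P / n * n := by gcongr; exact hV₁tr y
      _ = P := by field_simp
  set ε : ℝ := δ / Δ with hε
  have hε0 : 0 < ε := by positivity
  have herr : P * (2 * r ^ 2 * ε) ≤ η := by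
    refine le_trans ?_ hrδ
    calc P * (2 * r ^ 2 * ε) ≤ r * Δ * (2 * r ^ 2 * ε) := by gcongr
      _ = 2 * r ^ 3 * δ := by
        rw [hε]
        field_simp
  choose U hU hUlat hUtr hUerr using fun j => (hU₂ j).exists_lattice_approx hε0
  have hUP : ∀ j, (U j).trace ≤ P := fun j => by
    refine (hUtr j).trans ?_
    have h1 : (U₂ j).trace ≤ n / P * r := by
      rw [Matrix.trace_smul, smul_eq_mul]
      gcongr
      exact hU₁tr j
    have h2 : P * (n / P * r) = n * r := by field_simp
    have h3 : P * (r ^ 2 * ε) ≤ 1 := by linarith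
    have h4 := mul_le_mul_of_nonneg_left h1 hP0.le
    refine le_of_mul_le_mul_left ?_ hP0
    rw [hPsq, mul_add]
    nlinarith
  obtain ⟨i, hi⟩ := exists_barycentric_spanner
    (fun j => ((fun k => (a j k : ℝ)), U₂ j) : Option S → (Fin n → ℝ) × Matrix (Fin r) (Fin r) ℝ)
    (N := n + r ^ 2) (by simp [Module.finrank_matrix, sq])
  refine ⟨fun k => a (i k), fun k => b (i k), fun k => U (i k), fun k l => ?_, fun k => ?_,
    fun k => hU _, fun k => (hU _).opNorm_le_trace.trans (hUP _), fun k => hUlat _,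
    fun k l l' => ?_, Set.Subset.antisymm (fun x hx => ⟨h𝒳01 x hx, ?_⟩) ?_⟩
  · exact (ha (i k) l).trans (by linarith)
  · exact (hb (i k)).trans (by linarith)
  · refine ((hU _).abs_apply_le_trace l l').trans ((hUP _).trans (hPle.trans ?_))
    have : (r : ℝ) ≤ (r : ℝ) ^ ((3 : ℝ) / 2) := Real.self_le_rpow_of_one_le hr1 (by norm_num)
    gcongr
    linarith
  all_goals
    have hround : ∀ (Y : Matrix (Fin r) (Fin r) ℝ), opNorm Y ≤ P → ∀ j,
        |(Y * U j).trace - (Y * U₂ j).trace| ≤ η := fun Y hY j => by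
      rw [← Matrix.trace_sub, ← Matrix.mul_sub]
      refine (abs_trace_mul_le fun k l => (abs_apply_le_opNorm Y k l).trans hY).trans ?_
      exact (mul_le_mul_of_nonneg_left (hUerr j) hP0.le).trans herr
  · refine ⟨V₂ ⟨x, hx⟩, hV₂ _, hV₂P _, fun k => ?_⟩
    have h1 := abs_le.mp (hround _ (hV₂P ⟨x, hx⟩) (i k))
    have h2 := abs_le.mp (hUV₂ (i k) ⟨x, hx⟩)
    simp only [hη2, abs_le]
    constructor <;> linarith
  · rintro x ⟨hx01, Y, hY, hYP, hres⟩
    by_contra hx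
    obtain ⟨ν, hν, hsum⟩ := hi (some ⟨x, hx01, hx⟩)
    set j : Option S := some ⟨x, hx01, hx⟩
    obtain ⟨y₀, hy₀⟩ := h𝒳ne
    have hlin : ∀ (z : Fin n → ℝ) (Z : Matrix (Fin r) (Fin r) ℝ),
        (fun k => (a j k : ℝ)) ⬝ᵥ z + (Z * U₂ j).trace =
          ∑ k, ν k * ((fun l => (a (i k) l : ℝ)) ⬝ᵥ z + (Z * U₂ (i k)).trace) := by
      intro z Z
      have h1 := congrArg Prod.fst hsum
      have h2 := congrArg Prod.snd hsum
      simp only [Prod.fst_sum, Prod.snd_sum, Prod.smul_fst, Prod.smul_snd] at h1 h2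
      rw [h1, h2]
      simp [sum_dotProduct, Matrix.mul_sum, Matrix.trace_sum, mul_add, Finset.sum_add_distrib]
    have hneg : (b j : ℝ) - (fun k => (a j k : ℝ)) ⬝ᵥ x - (Y * U₂ j).trace ≤ -1 := by
      have h1 := hsep j ⟨x, hx01, hx⟩ rfl
      have h2 := hY.trace_mul_nonneg' (hU₂ j)
      linarith
    have hbase := abs_le.mp (hUV₂ j ⟨y₀, hy₀⟩)
    have hterm : ∀ k, |ν k * ((fun l => (a (i k) l : ℝ)) ⬝ᵥ x + (Y * U₂ (i k)).trace) -
        ν k * ((fun l => (a (i k) l : ℝ)) ⬝ᵥ y₀ + (V₂ ⟨y₀, hy₀⟩ * U₂ (i k)).trace)| ≤ 4 * η := by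
      intro k
      rw [← mul_sub, abs_mul]
      refine (mul_le_of_le_one_left (abs_nonneg _) (hν k)).trans ?_
      have h1 := abs_le.mp (hres k)
      simp only [hη2] at h1
      have h2 := abs_le.mp (hround Y hYP (i k))
      have h3 := abs_le.mp (hUV₂ (i k) ⟨y₀, hy₀⟩)
      rw [abs_le]
      constructor <;> linarith
    have hdiff : |((fun k => (a j k : ℝ)) ⬝ᵥ x + (Y * U₂ j).trace) -
        ((fun k => (a j k : ℝ)) ⬝ᵥ y₀ + (V₂ ⟨y₀, hy₀⟩ * U₂ j).trace)| ≤ N * (4 * η) := by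
      rw [hlin, hlin, ← Finset.sum_sub_distrib]
      refine (Finset.abs_sum_le_sum_abs _ _).trans ((Finset.sum_le_sum fun k _ => hterm k).trans ?_)
      simp [hN]
    have hη8 : η ≤ 1 / 8 := by nlinarith
    have := (abs_le.mp hdiff).2
    linarith
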